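/- arXiv:2204.07398 — 3 statements merged into one kernel-verified Lean document; each statement's English description precedes it below -/
import Mathlib

section
/- Let P be a decreasing probability distribution on ℕ such that the series ∑_{j=1}^∞ P(j)·(1 + log₂ j + log₂ P(j)) converges. Then ∑_{j=1}^∞ P(j)·(1 + log₂ j + log₂ P(j)) ≤ 0. -/
open Finset

/-- Jensen's inequality for `x * log x` with weights of total mass at most one. -/
lemma mul_log_sum_le {ι : Type*} (s : Finset ι) (w x : ι → ℝ) (hw : ∀ i ∈ s, 0 ≤ w i)
    (hw1 : ∑ i ∈ s, w i ≤ 1) (hx : ∀ i ∈ s, 0 ≤ x i) :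
    (∑ i ∈ s, w i * x i) * Real.log (∑ i ∈ s, w i * x i) ≤
      ∑ i ∈ s, w i * (x i * Real.log (x i)) := by
  have h := Real.convexOn_mul_log.map_add_sum_le (t := s) (w := w) (p := x)
    (v := 1 - ∑ i ∈ s, w i) (q := 0) hw (by ring) hx (by linarith) (by simp)
  simpa using h

/-- Summation by parts for the layer weights `(n + 1) * (Q n - Q (n + 1))`. -/
lemma sum_succ_mul_sub (Q : ℕ → ℝ) (M : ℕ) :
    ∑ n ∈ range M, ((n : ℝ) + 1) * (Q n - Q (n + 1)) = ∑ n ∈ range M, Q n - M * Q M := by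
  induction M with
  | zero => simp
  | succ k ih => rw [sum_range_succ, ih, sum_range_succ]; push_cast; ring

/-- A finitely supported sequence is a combination of uniform sequences. -/
lemma sum_layers_eq (Q : ℕ → ℝ) {M i : ℕ} (hi : i ≤ M) (hQ : Q M = 0) :
    ∑ n ∈ range M, ((n : ℝ) + 1) * (Q n - Q (n + 1)) * (if i ≤ n then 1 / ((n : ℝ) + 1) else 0)
      = Q i := by
  have h : ∀ M, i ≤ M → ∑ n ∈ range M, ((n : ℝ) + 1) * (Q n - Q (n + 1)) *
      (if i ≤ n then 1 / ((n : ℝ) + 1) else 0) = Q i - Q M := by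
    intro M hM
    induction M, hM using Nat.le_induction with
    | base =>
      rw [sub_self]
      refine sum_eq_zero fun n hn => ?_
      rw [if_neg (by have := mem_range.1 hn; omega), mul_zero]
    | succ k hk ih =>
      rw [sum_range_succ, ih, if_pos hk]
      field_simp
      ring
  rw [h M hi, hQ, sub_zero]

lemma sum_two_mul_succ_div_sub_one (n : ℕ) :
    ∑ j ∈ range n, (2 * ((j : ℝ) + 1) / ((n : ℝ) + 1) - 1) = 0 := by
  have h : ∀ m : ℕ, ∑ j ∈ range m, (2 * ((j : ℝ) + 1)) = m * (m + 1) := by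
    intro m
    induction m with
    | zero => simp
    | succ k ih => rw [sum_range_succ, ih]; push_cast; ring
  rw [sum_sub_distrib, ← sum_div, h]
  simp
  field_simp
  ring

/-- The inequality for the uniform distribution on `{0, …, n}`. -/
lemma uniform_sum_nonpos {n N : ℕ} (hn : n ≤ N) :
    ∑ j ∈ range N, ((if j + 1 ≤ n then 1 / ((n : ℝ) + 1) else 0) * Real.log (2 * ((j : ℝ) + 1)) +
      (if j + 1 ≤ n then 1 / ((n : ℝ) + 1) else 0) *
        Real.log (if j + 1 ≤ n then 1 / ((n : ℝ) + 1) else 0)) ≤ 0 := by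
  rw [← sum_subset (range_mono hn) fun j _ hj => by
    rw [mem_range] at hj
    rw [if_neg (by omega)]; simp]
  calc _ ≤ ∑ j ∈ range n, 1 / ((n : ℝ) + 1) * (2 * ((j : ℝ) + 1) / ((n : ℝ) + 1) - 1) := by
        refine sum_le_sum fun j hj => ?_
        rw [if_pos (by have := mem_range.1 hj; omega), ← mul_add,
          ← Real.log_mul (by positivity) (by positivity), mul_one_div]
        exact mul_le_mul_of_nonneg_left (Real.log_le_sub_one_of_pos (by positivity))
          (by positivity)
    _ = 0 := by rw [← mul_sum, sum_two_mul_succ_div_sub_one, mul_zero]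

/-- The inequality for a decreasing finitely supported sequence of total mass at most one. -/
lemma sum_mul_log_nonpos_of_antitone (Q : ℕ → ℝ) (N : ℕ) (hQ : Antitone Q)
    (hQN : Q (N + 1) = 0) (hsum : ∑ n ∈ range (N + 1), Q n ≤ 1) :
    ∑ j ∈ range N, (Q (j + 1) * Real.log (2 * ((j : ℝ) + 1)) +
      Q (j + 1) * Real.log (Q (j + 1))) ≤ 0 := by
  set w : ℕ → ℝ := fun n => ((n : ℝ) + 1) * (Q n - Q (n + 1)) with hw
  set U : ℕ → ℕ → ℝ := fun n j => if j + 1 ≤ n then 1 / ((n : ℝ) + 1) else 0 with hU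
  have hw0 : ∀ n, 0 ≤ w n := fun n =>
    mul_nonneg (by positivity) (sub_nonneg.2 (hQ n.le_succ))
  have hU0 : ∀ n j, 0 ≤ U n j := fun n j => by
    simp only [hU]; split_ifs <;> positivity
  have hw1 : ∑ n ∈ range (N + 1), w n ≤ 1 := by
    rw [hw, sum_succ_mul_sub, hQN]; simpa using hsum
  calc _ ≤ ∑ j ∈ range N, ∑ n ∈ range (N + 1),
        w n * (U n j * Real.log (2 * ((j : ℝ) + 1)) + U n j * Real.log (U n j)) := by
        refine sum_le_sum fun j hj => ?_
        have hj' := mem_range.1 hj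
        have e : ∑ n ∈ range (N + 1), w n * U n j = Q (j + 1) :=
          sum_layers_eq Q (by omega) hQN
        have h := mul_log_sum_le (range (N + 1)) w (fun n => U n j) (fun n _ => hw0 n) hw1
          (fun n _ => hU0 n j)
        simp only [mul_add, sum_add_distrib]
        rw [← e]
        refine add_le_add (le_of_eq ?_) h
        rw [sum_mul]
        exact sum_congr rfl fun n _ => by ring
    _ = ∑ n ∈ range (N + 1), w n *
        ∑ j ∈ range N, (U n j * Real.log (2 * ((j : ℝ) + 1)) + U n j * Real.log (U n j)) := by
        rw [sum_comm]; simp only [mul_sum]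
    _ ≤ 0 := sum_nonpos fun n hn => mul_nonpos_of_nonneg_of_nonpos (hw0 n)
        (uniform_sum_nonpos (by have := mem_range.1 hn; omega))

/-- For a DPD `P` on ℕ such that the series
`∑_{j=1}^∞ P(j)·(1 + log₂ j + log₂ P(j))` converges, its sum is at most `0`. -/
theorem stmt_10 (P : ℕ → ℝ)
    (hnonneg : ∀ m, 0 ≤ P m)
    (hmono : ∀ m, P (m + 1) ≤ P m)
    (hsum : HasSum P 1)
    (hconv : Summable (fun j : ℕ =>
      P (j + 1) * (1 + Real.logb 2 (j + 1) + Real.logb 2 (P (j + 1))))) :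
    ∑' j : ℕ, P (j + 1) * (1 + Real.logb 2 (j + 1) + Real.logb 2 (P (j + 1))) ≤ 0 := by
  refine le_of_tendsto' hconv.hasSum.tendsto_sum_nat fun N => ?_
  have hanti : Antitone P := antitone_nat_of_succ_le hmono
  have h := sum_mul_log_nonpos_of_antitone (fun j => if j ≤ N then P j else 0) N
    (fun a b hab => by
      dsimp only
      split_ifs with h1 h2
      · exact hanti hab
      · omega
      · exact hnonneg _
      · exact le_rfl)
    (by simp)
    (by
      rw [sum_congr rfl fun n hn => if_pos (by have := mem_range.1 hn; omega)]
      exact sum_le_hasSum _ (fun i _ => hnonneg i) hsum)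
  have hlog : 0 < Real.log 2 := Real.log_pos one_lt_two
  refine (mul_nonpos_iff_pos_imp_nonpos.1 ?_).1 hlog
  rw [mul_sum]
  refine (le_of_eq (sum_congr rfl fun j hj => ?_)).trans h
  rw [if_pos (by have := mem_range.1 hj; omega), Real.log_mul (by positivity) (by positivity)]
  simp only [Real.logb]
  field_simp
end

section
/- Let P be a decreasing probability distribution on ℕ with 0 < P(0) < 1 whose entropy series converges. Then ∑_{i=0}^∞ ∑_{n=1}^∞ P(0)^i P(n)·(1 + log₂ n + log₂(i+1)) ≤ ∑_{i=0}^∞ ∑_{n=1}^∞ P(0)^i P(n)·(-log₂(P(0)^i P(n))), i.e., the left-hand double series is at most the entropy H(D_RLE) of the run-length dictionary. -/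
open Filter Topology

/-- Concavity of the logarithm on an interval of ratio at most two. -/
lemma sub_le_mul_logb_sub {x y : ℝ} (hx : 0 < x) (hxy : x ≤ y) (hy : y ≤ 2 * x) :
    y - x ≤ x * (Real.logb 2 y - Real.logb 2 x) := by
  have hy0 : 0 < y := hx.trans_le hxy
  have ht0 : 0 ≤ y / x - 1 := by
    rw [sub_nonneg, le_div_iff₀ hx]; linarith
  have ht1 : y / x - 1 ≤ 1 := by
    rw [sub_le_iff_le_add, div_le_iff₀ hx]; linarith
  have hb := rpow_one_add_le_one_add_mul_self (s := 1) (by norm_num) ht0 ht1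
  have h : y / x - 1 ≤ Real.logb 2 (y / x) := by
    rw [Real.le_logb_iff_rpow_le (by norm_num) (by positivity)]
    norm_num at hb ⊢
    exact hb
  rw [Real.logb_div hy0.ne' hx.ne'] at h
  have h2 := mul_le_mul_of_nonneg_left h hx.le
  rwa [mul_sub, mul_div_cancel₀ _ hx.ne', mul_one] at h2

lemma Antitone.succ_mul_le_sum_range {q : ℕ → ℝ} (hq : Antitone q) (n : ℕ) :
    ((n : ℝ) + 1) * q n ≤ ∑ k ∈ Finset.range (n + 1), q k := by
  have h := Finset.card_nsmul_le_sum (Finset.range (n + 1)) q (q n)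
    (fun k hk => hq (Nat.lt_succ_iff.mp (Finset.mem_range.mp hk)))
  simpa using h

lemma Antitone.le_sum_range_mul_neg_logb {q : ℕ → ℝ} (hq : Antitone q) (hq0 : 0 < q 0)
    (hnonneg : ∀ n, 0 ≤ q n) (N : ℕ) :
    (∑ k ∈ Finset.range (N + 1), q k)
        - (∑ k ∈ Finset.range (N + 1), q k) * Real.logb 2 (∑ k ∈ Finset.range (N + 1), q k) - q 0
      ≤ ∑ n ∈ Finset.range (N + 1), q n * (-Real.logb 2 ((n + 1) * q n)) := by
  induction N with
  | zero => simp
  | succ N ih =>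
    rw [Finset.sum_range_succ (fun n : ℕ => q n * (-Real.logb 2 ((n + 1) * q n))) (N + 1)]
    have hle := hq.succ_mul_le_sum_range (N + 1)
    rw [Finset.sum_range_succ q (N + 1)] at hle ⊢
    set x := ∑ k ∈ Finset.range (N + 1), q k with hx
    have hx0 : 0 < x := hq0.trans_le
      (Finset.single_le_sum (f := q) (fun k _ => hnonneg k) (Finset.mem_range.mpr N.succ_pos))
    have hqn := hnonneg (N + 1)
    have hqx : q (N + 1) ≤ x := by
      push_cast at hle
      nlinarith [mul_nonneg (Nat.cast_nonneg (α := ℝ) N) hqn]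
    have hlog := sub_le_mul_logb_sub hx0 (y := x + q (N + 1)) (by linarith) (by linarith)
    have hterm : q (N + 1) * (-Real.logb 2 (x + q (N + 1)))
        ≤ q (N + 1) * (-Real.logb 2 (((N + 1 : ℕ) + 1) * q (N + 1))) := by
      rcases hqn.eq_or_lt with h0 | hpos
      · simp [← h0]
      · have := Real.logb_le_logb_of_le (b := 2) (by norm_num) (by positivity) hle
        exact mul_le_mul_of_nonneg_left (by linarith) hqn
    nlinarith

/-- Lower bound for the entropy of a decreasing sequence relative to the code lengths `log₂ n`. -/
lemma Antitone.le_of_hasSum_mul_neg_logb {q : ℕ → ℝ} {m s : ℝ} (hq : Antitone q) (hq0 : 0 < q 0)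
    (hnonneg : ∀ n, 0 ≤ q n) (hm : 0 < m) (hsum : HasSum q m)
    (hs : HasSum (fun n : ℕ => q n * (-Real.logb 2 ((n + 1) * q n))) s) :
    m - m * Real.logb 2 m - q 0 ≤ s := by
  have h1 := hsum.tendsto_sum_nat.comp (tendsto_add_atTop_nat 1)
  have h2 := hs.tendsto_sum_nat.comp (tendsto_add_atTop_nat 1)
  have h3 := (Real.continuousAt_logb (b := 2) hm.ne').tendsto.comp h1
  exact le_of_tendsto_of_tendsto' ((h1.sub (h1.mul h3)).sub_const (q 0)) h2
    (hq.le_sum_range_mul_neg_logb hq0 hnonneg)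

lemma logb_two_le_tangent {x c : ℝ} (hx : 0 < x) (hc : 0 < c) :
    Real.logb 2 x ≤ (c * x - 1) / Real.log 2 - Real.logb 2 c := by
  have h := Real.log_le_sub_one_of_pos (mul_pos hc hx)
  rw [Real.log_mul hc.ne' hx.ne'] at h
  have h2 : 0 < Real.log 2 := Real.log_pos (by norm_num)
  rw [Real.logb, Real.logb, ← sub_div, div_le_div_iff_of_pos_right h2]
  linarith

lemma hasSum_mul_pow {p : ℝ} (hp0 : 0 < p) (hp1 : p < 1) :
    HasSum (fun i : ℕ => (i : ℝ) * p ^ i) (p / (1 - p) ^ 2) :=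
  hasSum_coe_mul_geometric_of_norm_lt_one (by rwa [Real.norm_of_nonneg hp0.le])

lemma summable_pow_mul_logb_succ {p : ℝ} (hp0 : 0 < p) (hp1 : p < 1) :
    Summable (fun i : ℕ => p ^ i * Real.logb 2 (i + 1)) := by
  refine Summable.of_nonneg_of_le (fun i => ?_) (fun i => ?_) (hasSum_mul_pow hp0 hp1).summable
  · have := Real.logb_nonneg (b := 2) (x := (i : ℝ) + 1) (by norm_num) (by simp)
    positivity
  · have h : Real.logb 2 ((i : ℝ) + 1) ≤ i := by
      rw [Real.logb_le_iff_le_rpow (by norm_num) (by positivity), Real.rpow_natCast]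
      exact_mod_cast Nat.lt_two_pow_self (n := i)
    rw [mul_comm]
    exact mul_le_mul_of_nonneg_right h (by positivity)

/-- Jensen's inequality for the logarithm of a geometric random variable. -/
lemma mul_tsum_pow_mul_logb_succ_le {p : ℝ} (hp0 : 0 < p) (hp1 : p < 1) :
    (1 - p) * ∑' i : ℕ, p ^ i * Real.logb 2 (i + 1) ≤ -Real.logb 2 (1 - p) := by
  have hm : 0 < 1 - p := sub_pos.mpr hp1
  have hlog2 : 0 < Real.log 2 := Real.log_pos (by norm_num)
  have hgeo := hasSum_geometric_of_lt_one hp0.le hp1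
  have hbound := ((hasSum_mul_pow hp0 hp1).mul_left ((1 - p) / Real.log 2)).add
    (hgeo.mul_left (-p / Real.log 2 - Real.logb 2 (1 - p)))
  have h := hasSum_le (fun i : ℕ => ?_) (summable_pow_mul_logb_succ hp0 hp1).hasSum hbound
  · refine (mul_le_mul_of_nonneg_left h hm.le).trans_eq ?_
    field_simp
    ring
  · have ht := mul_le_mul_of_nonneg_left
      (logb_two_le_tangent (x := (i : ℝ) + 1) (by positivity) hm) (pow_nonneg hp0.le i)
    refine ht.trans_eq ?_
    field_simp
    ring

/-- For a DPD `P` with `0 < P 0 < 1` and convergent entropy series,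
`∑_{i,n} P(0)^i P(n)·(1 + log₂ n + log₂(i+1))
  ≤ ∑_{i,n} P(0)^i P(n)·(-log₂(P(0)^i P(n))) = H(D_RLE)`. -/
theorem stmt_11 (P : ℕ → ℝ)
    (hnonneg : ∀ m, 0 ≤ P m)
    (hmono : ∀ m, P (m + 1) ≤ P m)
    (hsum : HasSum P 1)
    (hP0 : 0 < P 0) (hP0' : P 0 < 1)
    (hent : Summable (fun n => P n * Real.logb 2 (P n))) :
    (∑' i : ℕ, ∑' n : ℕ,
        P 0 ^ i * P (n + 1) * (1 + Real.logb 2 (n + 1) + Real.logb 2 (i + 1)))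
      ≤ ∑' i : ℕ, ∑' n : ℕ,
          P 0 ^ i * P (n + 1) * (-Real.logb 2 (P 0 ^ i * P (n + 1))) := by
  have hm : 0 < 1 - P 0 := sub_pos.mpr hP0'
  have hq : HasSum (fun n => P (n + 1)) (1 - P 0) := by
    simpa using (hasSum_nat_add_iff' 1).mpr hsum
  have hanti : Antitone (fun n => P (n + 1)) := antitone_nat_of_succ_le fun n => hmono (n + 1)
  have hq0 : 0 < P 1 := by
    refine (hnonneg 1).lt_of_ne fun h => hm.ne' (hq.unique ?_)
    have hz : (fun n => P (n + 1)) = fun _ => 0 :=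
      funext fun n => le_antisymm ((hanti (Nat.zero_le n)).trans_eq h.symm) (hnonneg _)
    rw [hz]
    exact hasSum_zero
  have hq_le : P 1 ≤ 1 - P 0 := le_hasSum hq 0 fun n _ => hnonneg (n + 1)
  have hent' : Summable (fun n : ℕ => P (n + 1) * (-Real.logb 2 (P (n + 1)))) := by
    simpa using ((summable_nat_add_iff 1).mpr hent).neg
  have hlen : Summable (fun n : ℕ => P (n + 1) * Real.logb 2 ((n : ℝ) + 1)) := by
    refine Summable.of_nonneg_of_le (fun n => ?_) (fun n => ?_) hent'
    · exact mul_nonneg (hnonneg _) (Real.logb_nonneg (by norm_num) (by simp))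
    · rcases (hnonneg (n + 1)).eq_or_lt with h0 | hpos
      · simp [← h0]
      · have h1 : ((n : ℝ) + 1) * P (n + 1) ≤ 1 := by
          have := hanti.succ_mul_le_sum_range n
          have := sum_le_hasSum (Finset.range (n + 1)) (fun k _ => hnonneg (k + 1)) hq
          linarith
        have h2 := Real.logb_nonpos (b := 2) (by norm_num) (by positivity) h1
        rw [Real.logb_mul (by positivity) hpos.ne'] at h2
        exact mul_le_mul_of_nonneg_left (by linarith) hpos.le
  set L := ∑' n : ℕ, P (n + 1) * Real.logb 2 ((n : ℝ) + 1) with hL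
  set h := ∑' n : ℕ, P (n + 1) * (-Real.logb 2 (P (n + 1))) with hh
  have hkey : (1 - P 0) - (1 - P 0) * Real.logb 2 (1 - P 0) - P 1 ≤ h - L := by
    refine hanti.le_of_hasSum_mul_neg_logb hq0 (fun n => hnonneg _) hm hq ?_
    refine (hent'.hasSum.sub hlen.hasSum).congr_fun fun n => ?_
    rcases (hnonneg (n + 1)).eq_or_lt with h0 | hpos
    · simp [← h0]
    · rw [Real.logb_mul (by positivity) hpos.ne']
      ring
  have hfirst : P 1 ≤ -(P 0 * Real.logb 2 (P 0)) := by
    rcases le_total (P 0) (1 / 2) with hle | hle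
    · have h1 := Real.logb_le_logb_of_le (b := 2) (by norm_num) hP0 hle
      rw [one_div, Real.logb_inv, Real.logb_self_eq_one (by norm_num)] at h1
      nlinarith [hmono 0]
    · have h1 := sub_le_mul_logb_sub hP0 hP0'.le (by linarith)
      rw [Real.logb_one] at h1
      linarith
  have hgeo := hasSum_geometric_of_lt_one hP0.le hP0'
  have hleft : (∑' i : ℕ, ∑' n : ℕ,
      P 0 ^ i * P (n + 1) * (1 + Real.logb 2 (n + 1) + Real.logb 2 (i + 1)))
        = ((1 - P 0) + L) * (1 - P 0)⁻¹
          + (1 - P 0) * ∑' i : ℕ, P 0 ^ i * Real.logb 2 (i + 1) := by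
    refine HasSum.tsum_eq (((hgeo.mul_left ((1 - P 0) + L)).add
      ((summable_pow_mul_logb_succ hP0 hP0').hasSum.mul_left (1 - P 0))).congr_fun fun i => ?_)
    refine (HasSum.tsum_eq (((hq.mul_left (P 0 ^ i * (1 + Real.logb 2 (i + 1)))).add
      (hlen.hasSum.mul_left (P 0 ^ i))).congr_fun fun n => ?_)).trans ?_
    · ring
    · rw [← hL]; ring
  have hright : (∑' i : ℕ, ∑' n : ℕ,
      P 0 ^ i * P (n + 1) * (-Real.logb 2 (P 0 ^ i * P (n + 1))))
        = h * (1 - P 0)⁻¹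
          + (1 - P 0) * (-Real.logb 2 (P 0)) * (P 0 / (1 - P 0) ^ 2) := by
    refine HasSum.tsum_eq (((hgeo.mul_left h).add ((hasSum_mul_pow hP0 hP0').mul_left
      ((1 - P 0) * (-Real.logb 2 (P 0))))).congr_fun fun i => ?_)
    refine (HasSum.tsum_eq (((hq.mul_left (P 0 ^ i * (i * (-Real.logb 2 (P 0))))).add
      (hent'.hasSum.mul_left (P 0 ^ i))).congr_fun fun n => ?_)).trans ?_
    · rcases (hnonneg (n + 1)).eq_or_lt with h0 | hpos
      · simp [← h0]
      · rw [Real.logb_mul (by positivity) hpos.ne', Real.logb_pow]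
        ring
    · rw [← hh]; ring
  rw [hleft, hright]
  have hjensen := mul_tsum_pow_mul_logb_succ_le hP0 hP0'
  calc _ ≤ ((1 - P 0) + L) * (1 - P 0)⁻¹ + -Real.logb 2 (1 - P 0) := by linarith
    _ = ((1 - P 0) + L - (1 - P 0) * Real.logb 2 (1 - P 0)) * (1 - P 0)⁻¹ := by
      field_simp
      ring
    _ ≤ (h - P 0 * Real.logb 2 (P 0)) * (1 - P 0)⁻¹ :=
      mul_le_mul_of_nonneg_right (by linarith) (by positivity)
    _ = _ := by
      field_simp
      ring
end

section
/- Let P be a decreasing probability distribution on ℕ with 0 < P(0) < 1 whose entropy series converges. For the Elias γ length function L_γ(n) = 1 + 2·⌊log₂ n⌋ (n ≥ 1), one has (1 - P(0)) · ∑_{i=0}^∞ ∑_{n=1}^∞ P(0)^i P(n)·(L_γ(i+1) + L_γ(n)) ≤ 2 · H(P). That is, the RLE-based VV code built from the Elias γ code is a generalized universal code of integers with expansion factor K_C = 2. -/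
open Real

/-- The integer part of the binary logarithm, in nats, is at most the natural logarithm. -/
lemma natLog_two_mul_log_le (n : ℕ) : (Nat.log 2 n : ℝ) * log 2 ≤ log n := by
  have h := Real.natLog_le_logb n 2
  have h2 : 0 < log 2 := log_pos one_lt_two
  rwa [Nat.cast_ofNat, logb, le_div_iff₀ h2] at h

lemma natLog_two_succ_le (i : ℕ) :
    (Nat.log 2 (i + 1) : ℝ) ≤ i - 1 + (if i = 0 then 1 else 0) + (if i = 1 then 1 else 0) := by
  match i with
  | 0 => simp
  | 1 => norm_num [Nat.log_of_one_lt_of_le]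
  | j + 2 =>
    have hpow : j + 2 + 1 < 2 ^ (j + 2) := by
      induction j with
      | zero => norm_num
      | succ k ih => rw [show k + 1 + 2 = (k + 2) + 1 by ring, pow_succ]; omega
    have h : Nat.log 2 (j + 2 + 1) ≤ j + 1 :=
      Nat.lt_succ_iff.mp (Nat.log_lt_of_lt_pow (by omega) hpow)
    have h' : (Nat.log 2 (j + 2 + 1) : ℝ) ≤ j + 1 := by exact_mod_cast h
    simp only [Nat.cast_add, Nat.cast_ofNat]
    simp
    linarith

section Geometric

variable {p : ℝ}

lemma hasSum_geometric_mul_affine (hp : 0 ≤ p) (hp' : p < 1) (a b : ℝ) :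
    HasSum (fun i : ℕ => p ^ i * (a + b * i)) (a / (1 - p) + b * (p / (1 - p) ^ 2)) := by
  have h1 := (hasSum_geometric_of_lt_one hp hp').mul_left a
  have h2 := (hasSum_coe_mul_geometric_of_norm_lt_one
    (r := p) (by rwa [norm_of_nonneg hp])).mul_left b
  have h := h1.add h2
  rw [← div_eq_mul_inv] at h
  have hfun : (fun i : ℕ => p ^ i * (a + b * i)) =
      fun i : ℕ => a * p ^ i + b * (i * p ^ i) := by
    funext i
    ring
  rwa [hfun]

lemma summable_geometric_mul_natLog (hp : 0 ≤ p) (hp' : p < 1) :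
    Summable (fun i : ℕ => p ^ i * (Nat.log 2 (i + 1) : ℝ)) := by
  refine Summable.of_nonneg_of_le (fun i => by positivity) (fun i => ?_)
    (hasSum_geometric_mul_affine hp hp' 1 1).summable
  gcongr
  have h : Nat.log 2 (i + 1) ≤ 1 + i := by
    simpa [add_comm] using Nat.log_le_self 2 (i + 1)
  rw [one_mul]
  exact_mod_cast h

/-- Jensen's inequality for the logarithm under a geometric distribution. -/
lemma geometric_natLog_mul_log_two_le (hp : 0 ≤ p) (hp' : p < 1) :
    (1 - p) * (∑' i : ℕ, p ^ i * (Nat.log 2 (i + 1) : ℝ)) * log 2 ≤ -log (1 - p) := by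
  have hq : 0 < 1 - p := by linarith
  have hs := (summable_geometric_mul_natLog hp hp').mul_right (log 2)
  have ha := hasSum_geometric_mul_affine hp hp' (-log (1 - p) - p) (1 - p)
  have hle := hs.tsum_le_tsum (fun i => ?_) ha.summable
  · rw [ha.tsum_eq, tsum_mul_right] at hle
    calc _ = (1 - p) * ((∑' i : ℕ, p ^ i * (Nat.log 2 (i + 1) : ℝ)) * log 2) := by ring
      _ ≤ (1 - p) * ((-log (1 - p) - p) / (1 - p) + (1 - p) * (p / (1 - p) ^ 2)) := by gcongr
      _ = -log (1 - p) := by field_simp; ring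
  · rw [mul_assoc]
    refine mul_le_mul_of_nonneg_left ?_ (by positivity)
    have hi : (0 : ℝ) < i + 1 := by positivity
    have h1 := natLog_two_mul_log_le (i + 1)
    have h2 := log_le_sub_one_of_pos (mul_pos hi hq)
    rw [log_mul hi.ne' hq.ne'] at h2
    push_cast at h1
    linarith

lemma geometric_natLog_le (hp : 0 ≤ p) (hp' : p < 1) :
    (1 - p) * (∑' i : ℕ, p ^ i * (Nat.log 2 (i + 1) : ℝ)) ≤ p / (1 - p) - p ^ 2 := by
  have hq : 0 < 1 - p := by linarith
  have ha := ((hasSum_geometric_mul_affine hp hp' (-1) 1).add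
    (hasSum_ite_eq (0 : ℕ) (1 : ℝ))).add (hasSum_ite_eq (1 : ℕ) p)
  have hle := (summable_geometric_mul_natLog hp hp').tsum_le_tsum (fun i => ?_) ha.summable
  · rw [ha.tsum_eq] at hle
    calc _ ≤ (1 - p) * (-1 / (1 - p) + 1 * (p / (1 - p) ^ 2) + 1 + p) := by gcongr
      _ = p / (1 - p) - p ^ 2 := by field_simp; ring
  · have h := mul_le_mul_of_nonneg_left (natLog_two_succ_le i) (pow_nonneg hp i)
    refine h.trans_eq ?_
    rcases i with _ | _ | i <;> simp

end Geometric

section Numeric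

variable {p : ℝ}

lemma one_sub_mul_log_two_le_negMulLog (hp : 1 / 2 ≤ p) (hp' : p ≤ 1) :
    (1 - p) * log 2 ≤ negMulLog p := by
  have h := concaveOn_negMulLog.2 (Set.mem_Ici.2 (by norm_num : (0 : ℝ) ≤ 1 / 2))
    (Set.mem_Ici.2 zero_le_one) (by linarith : 0 ≤ 2 * (1 - p)) (by linarith : 0 ≤ 2 * p - 1)
    (by ring)
  have h2 : negMulLog (1 / 2) = log 2 / 2 := by
    rw [negMulLog, one_div, log_inv]; ring
  simp only [smul_eq_mul, h2, negMulLog_one] at h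
  have h3 : 2 * (1 - p) * (1 / 2) + (2 * p - 1) * 1 = p := by ring
  rw [h3] at h
  linarith

lemma log_two_mul_le_binEntropy_four_elevenths :
    41 / 44 * log 2 ≤ binEntropy (4 / 11) := by
  have h11 : (0 : ℝ) < 11 := by norm_num
  have h4 : log 4 = 2 * log 2 := by
    rw [show (4 : ℝ) = 2 ^ 2 by norm_num, log_pow]; norm_num
  have hpow : log ((2 : ℝ) ^ 73 * 7 ^ 28) ≤ log (11 ^ 44) :=
    log_le_log (by norm_num) (by norm_num)
  rw [log_mul (by norm_num) (by norm_num), log_pow, log_pow, log_pow] at hpow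
  rw [binEntropy_eq_negMulLog_add_negMulLog_one_sub, negMulLog, negMulLog,
    show (1 : ℝ) - 4 / 11 = 7 / 11 by norm_num, log_div (by norm_num) h11.ne',
    log_div (by norm_num) h11.ne', h4]
  push_cast at hpow
  linarith

lemma geometric_codeLength_le_one (hp : 0 ≤ p) (hp' : p ≤ 4 / 11) :
    log 2 * (1 + (p / (1 - p) - p ^ 2)) ≤ 1 := by
  have hq : 0 < 1 - p := by linarith
  have h : 1 + (p / (1 - p) - p ^ 2) ≤ 1.44 := by
    have h1 : p / (1 - p) ≤ 0.44 + p ^ 2 := by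
      rw [div_le_iff₀ hq]
      nlinarith [mul_nonneg hp (sub_nonneg.2 hp'), mul_nonneg hp (mul_nonneg hp (sub_nonneg.2 hp'))]
    linarith
  have h2 := log_two_lt_d9
  have h3 : 0 < log 2 := log_pos one_lt_two
  nlinarith

lemma codeLength_le_binEntropy_of_mid (hp : 4 / 11 ≤ p) (hp' : p ≤ 1 / 2) :
    log 2 * ((1 - p) * (1 + (p / (1 - p) - p ^ 2))) ≤ binEntropy p := by
  have hq : 0 < 1 - p := by linarith
  have h2 : 0 < log 2 := log_pos one_lt_two
  have hmono : binEntropy (4 / 11) ≤ binEntropy p :=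
    binEntropy_strictMonoOn.monotoneOn ⟨by norm_num, by norm_num⟩
      ⟨by linarith, by linarith⟩ hp
  have heq : (1 - p) * (1 + (p / (1 - p) - p ^ 2)) = 1 - p * (p * (1 - p)) := by
    field_simp; ring
  have hpq : 28 / 121 ≤ p * (1 - p) := by nlinarith
  have hle : 1 - p * (p * (1 - p)) ≤ 41 / 44 := by nlinarith
  rw [heq]
  nlinarith [log_two_mul_le_binEntropy_four_elevenths]

/-- If `E` obeys the two bounds on the mean of `⌊log₂ (i + 1)⌋` under a geometric distribution, then
`(1 - p) (1 + E)` is at most the binary entropy of `p` as soon as `p ≥ 4 / 11`. -/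
lemma codeLength_le_binEntropy {E : ℝ} (hp : 4 / 11 ≤ p) (hp' : p < 1)
    (hE : E * log 2 ≤ -log (1 - p)) (hE' : E ≤ p / (1 - p) - p ^ 2) :
    log 2 * ((1 - p) * (1 + E)) ≤ binEntropy p := by
  have hq : 0 < 1 - p := by linarith
  have h2 : 0 < log 2 := log_pos one_lt_two
  rcases le_total p (1 / 2) with h | h
  · refine le_trans ?_ (codeLength_le_binEntropy_of_mid hp h)
    gcongr
  · have h3 := one_sub_mul_log_two_le_negMulLog h hp'.le
    have h4 := mul_le_mul_of_nonneg_left hE hq.le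
    rw [binEntropy_eq_negMulLog_add_negMulLog_one_sub, congrFun negMulLog_def (1 - p)]
    linarith

end Numeric

section Entropy

variable {P : ℕ → ℝ}

lemma Antitone.mul_le_sum_range (hP : Antitone P) (n : ℕ) :
    (n : ℝ) * P n ≤ ∑ k ∈ Finset.range n, P k := by
  have h := Finset.card_nsmul_le_sum (Finset.range n) P (P n)
    (fun k hk => hP (Finset.mem_range.1 hk).le)
  simpa using h

/-- One step of the chain rule: adding a mass `x` to a total mass `S` with `m * x ≤ S`. -/
lemma mul_one_add_log_le {S x m : ℝ} (hS : 0 < S) (hx : 0 ≤ x) (hm : 0 < m) (h : m * x ≤ S) :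
    x * (1 + log m) ≤ negMulLog x + (S + x) * log (S + x) - S * log S := by
  rcases hx.eq_or_lt with rfl | hx
  · simp
  have h1 : log m + log x ≤ log S := by
    rw [← log_mul hm.ne' hx.ne']
    exact log_le_log (by positivity) h
  have h2 := one_sub_inv_le_log_of_pos (div_pos (add_pos hS hx) hS)
  rw [log_div (by positivity) hS.ne', inv_div] at h2
  have h3 : x ≤ (S + x) * (log (S + x) - log S) := by
    calc x = (S + x) * (1 - S / (S + x)) := by field_simp; ring
      _ ≤ _ := by gcongr
  have h4 := mul_le_mul_of_nonneg_left h1 hx.le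
  rw [negMulLog]
  linarith

lemma sum_mul_one_add_log_le (hnonneg : ∀ n, 0 ≤ P n) (hP : Antitone P) (hP0 : 0 < P 0) (M : ℕ) :
    ∑ n ∈ Finset.range M, P (n + 1) * (1 + log (n + 1)) ≤
      ∑ n ∈ Finset.range (M + 1), negMulLog (P n) +
        (∑ n ∈ Finset.range (M + 1), P n) * log (∑ n ∈ Finset.range (M + 1), P n) := by
  induction M with
  | zero => simp [negMulLog]
  | succ M ih =>
    have hS : 0 < ∑ n ∈ Finset.range (M + 1), P n :=
      Finset.sum_pos' (fun n _ => hnonneg n) ⟨0, by simp, hP0⟩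
    have h := mul_one_add_log_le hS (hnonneg (M + 1)) (by positivity : (0 : ℝ) < M + 1)
      (by exact_mod_cast hP.mul_le_sum_range (M + 1))
    rw [Finset.sum_range_succ, Finset.sum_range_succ (fun n => negMulLog (P n)),
      Finset.sum_range_succ P (M + 1)]
    linarith

lemma tail_mass_add_natLog_le_entropy (hnonneg : ∀ n, 0 ≤ P n) (hP : Antitone P)
    (hsum : HasSum P 1) (hP0 : 0 < P 0) (hent : Summable fun n => negMulLog (P n))
    (hT : Summable fun n => P (n + 1) * (Nat.log 2 (n + 1) : ℝ)) :
    (1 - P 0) + (∑' n, P (n + 1) * (Nat.log 2 (n + 1) : ℝ)) * log 2 ≤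
      ∑' n, negMulLog (P n) := by
  have h2 : 0 < log 2 := log_pos one_lt_two
  have htail : HasSum (fun n => P (n + 1)) (1 - P 0) := by
    simpa using (hasSum_nat_add_iff' 1).2 hsum
  have hle1 : ∀ n, P n ≤ 1 := fun n => le_hasSum hsum n fun k _ => hnonneg k
  rw [← (htail.add (hT.hasSum.mul_right (log 2))).tsum_eq]
  refine Real.tsum_le_of_sum_range_le (fun n => ?_) (fun M => ?_)
  · have := hnonneg (n + 1)
    positivity
  · have hS0 : 0 ≤ ∑ n ∈ Finset.range (M + 1), P n := Finset.sum_nonneg fun n _ => hnonneg n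
    have hS1 : ∑ n ∈ Finset.range (M + 1), P n ≤ 1 :=
      sum_le_hasSum _ (fun n _ => hnonneg n) hsum
    calc _ ≤ ∑ n ∈ Finset.range M, P (n + 1) * (1 + log (n + 1)) := by
          refine Finset.sum_le_sum fun n _ => ?_
          have h := mul_le_mul_of_nonneg_left (natLog_two_mul_log_le (n + 1)) (hnonneg (n + 1))
          push_cast at h
          linarith
      _ ≤ ∑ n ∈ Finset.range (M + 1), negMulLog (P n) := by
          have h := sum_mul_one_add_log_le hnonneg hP hP0 M
          have h' := mul_log_nonpos hS0 hS1
          linarith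
      _ ≤ _ := hent.sum_le_tsum _ fun n _ => negMulLog_nonneg (hnonneg n) (hle1 n)

lemma mul_natLog_le_negMulLog_tail (hnonneg : ∀ n, 0 ≤ P n) (hP : Antitone P)
    (hsum : HasSum P 1) (hP0' : P 0 < 1) (n : ℕ) :
    P (n + 1) * (Nat.log 2 (n + 1) : ℝ) * log 2 ≤
      negMulLog (P (n + 1)) + P (n + 1) * log (1 - P 0) := by
  have htail : HasSum (fun n => P (n + 1)) (1 - P 0) := by
    simpa using (hasSum_nat_add_iff' 1).2 hsum
  have hq : 0 < 1 - P 0 := by linarith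
  rcases (hnonneg (n + 1)).eq_or_lt with h0 | h0
  · simp [← h0]
  have hbound : ((n + 1 : ℕ) : ℝ) * P (n + 1) ≤ 1 - P 0 := by
    have h := Finset.card_nsmul_le_sum (Finset.range (n + 1)) (fun k => P (k + 1)) (P (n + 1))
      (fun k hk => hP (by have := Finset.mem_range.1 hk; omega))
    simp only [Finset.card_range, nsmul_eq_mul] at h
    exact h.trans (sum_le_hasSum _ (fun k _ => hnonneg (k + 1)) htail)
  have hlog := log_le_log (by positivity) hbound
  rw [log_mul (by positivity) h0.ne'] at hlog
  have h1 := natLog_two_mul_log_le (n + 1)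
  have h3 : (Nat.log 2 (n + 1) : ℝ) * log 2 ≤ log (1 - P 0) - log (P (n + 1)) := by linarith
  have h4 := mul_le_mul_of_nonneg_left h3 h0.le
  rw [negMulLog]
  linarith

lemma summable_mul_natLog (hnonneg : ∀ n, 0 ≤ P n) (hP : Antitone P)
    (hsum : HasSum P 1) (hP0' : P 0 < 1) (hent : Summable fun n => negMulLog (P n)) :
    Summable fun n => P (n + 1) * (Nat.log 2 (n + 1) : ℝ) := by
  have h2 : 0 < log 2 := log_pos one_lt_two
  rw [← summable_mul_right_iff h2.ne']
  refine Summable.of_nonneg_of_le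
    (fun n => mul_nonneg (mul_nonneg (hnonneg _) (Nat.cast_nonneg _)) h2.le)
    (mul_natLog_le_negMulLog_tail hnonneg hP hsum hP0') ?_
  exact ((summable_nat_add_iff 1).2 hent).add
    (((summable_nat_add_iff 1).2 hsum.summable).mul_right _)

lemma binEntropy_add_natLog_le_entropy (hnonneg : ∀ n, 0 ≤ P n) (hP : Antitone P)
    (hsum : HasSum P 1) (hP0' : P 0 < 1) (hent : Summable fun n => negMulLog (P n)) :
    binEntropy (P 0) + (∑' n, P (n + 1) * (Nat.log 2 (n + 1) : ℝ)) * log 2 ≤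
      ∑' n, negMulLog (P n) := by
  have htail : HasSum (fun n => P (n + 1)) (1 - P 0) := by
    simpa using (hasSum_nat_add_iff' 1).2 hsum
  have hent' := (summable_nat_add_iff 1).2 hent
  have h := ((summable_mul_natLog hnonneg hP hsum hP0' hent).mul_right (log 2)).tsum_le_tsum
    (mul_natLog_le_negMulLog_tail hnonneg hP hsum hP0')
    (hent'.add (htail.summable.mul_right _))
  rw [hent'.tsum_add (htail.summable.mul_right _), tsum_mul_right, tsum_mul_right,
    htail.tsum_eq] at h
  rw [hent.tsum_eq_zero_add, binEntropy_eq_negMulLog_add_negMulLog_one_sub,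
    congrFun negMulLog_def (1 - P 0)]
  linarith

end Entropy

/-- The expected codeword length of the run-length code, summed over all blocks. -/
lemma tsum_runLength_codeLength {P : ℕ → ℝ} (hsum : HasSum P 1) (hP0 : 0 ≤ P 0) (hP0' : P 0 < 1)
    (hT : Summable fun n => P (n + 1) * (Nat.log 2 (n + 1) : ℝ)) :
    (1 - P 0) *
        ∑' i : ℕ, ∑' n : ℕ, P 0 ^ i * P (n + 1) *
          (((1 + 2 * Nat.log 2 (i + 1) : ℕ) : ℝ) + ((1 + 2 * Nat.log 2 (n + 1) : ℕ) : ℝ)) =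
      2 * ((1 - P 0) * (1 + (1 - P 0) * ∑' i : ℕ, P 0 ^ i * (Nat.log 2 (i + 1) : ℝ)) +
        ∑' n, P (n + 1) * (Nat.log 2 (n + 1) : ℝ)) := by
  have hq : 0 < 1 - P 0 := by linarith
  have htail : HasSum (fun n => P (n + 1)) (1 - P 0) := by
    simpa using (hasSum_nat_add_iff' 1).2 hsum
  have hinner : ∀ i : ℕ, ∑' n : ℕ, P 0 ^ i * P (n + 1) *
      (((1 + 2 * Nat.log 2 (i + 1) : ℕ) : ℝ) + ((1 + 2 * Nat.log 2 (n + 1) : ℕ) : ℝ)) =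
      P 0 ^ i * (2 * (1 - P 0) + 2 * ∑' n, P (n + 1) * (Nat.log 2 (n + 1) : ℝ)) +
        P 0 ^ i * (Nat.log 2 (i + 1) : ℝ) * (2 * (1 - P 0)) := by
    intro i
    have h := (htail.mul_left (P 0 ^ i * (2 + 2 * (Nat.log 2 (i + 1) : ℝ)))).add
      (hT.hasSum.mul_left (P 0 ^ i * 2))
    refine Eq.trans (tsum_congr fun n => ?_) (h.tsum_eq.trans ?_)
    · push_cast; ring
    · ring
  have houter := ((hasSum_geometric_of_lt_one hP0 hP0').mul_right
    (2 * (1 - P 0) + 2 * ∑' n, P (n + 1) * (Nat.log 2 (n + 1) : ℝ))).add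
    ((summable_geometric_mul_natLog hP0 hP0').hasSum.mul_right (2 * (1 - P 0)))
  rw [tsum_congr hinner, houter.tsum_eq]
  field_simp
  ring


/-- For a DPD `P` with `0 < P 0 < 1` and convergent entropy series, the
RLE-based VV code built from the Elias γ code, whose length function is
`L_γ(n) = 1 + 2⌊log₂ n⌋`, has coding rate at most `2·H(P)`:
`(1 - P 0) · ∑_{i,n} P(0)^i P(n)·(L_γ(i+1) + L_γ(n)) ≤ 2·H(P)`. -/
theorem stmt_13 (P : ℕ → ℝ)
    (hnonneg : ∀ m, 0 ≤ P m)
    (hmono : ∀ m, P (m + 1) ≤ P m)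
    (hsum : HasSum P 1)
    (hP0 : 0 < P 0) (hP0' : P 0 < 1)
    (hent : Summable (fun n => P n * Real.logb 2 (P n))) :
    (1 - P 0) *
        ∑' i : ℕ, ∑' n : ℕ, P 0 ^ i * P (n + 1) *
          (((1 + 2 * Nat.log 2 (i + 1) : ℕ) : ℝ) + ((1 + 2 * Nat.log 2 (n + 1) : ℕ) : ℝ))
      ≤ 2 * (-∑' n : ℕ, P n * Real.logb 2 (P n)) := by
  have hanti : Antitone P := antitone_nat_of_succ_le hmono
  have h2 : 0 < log 2 := log_pos one_lt_two
  have hterm : ∀ n, negMulLog (P n) = -(P n * logb 2 (P n)) * log 2 := fun n => by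
    rw [negMulLog, logb]; field_simp
  have hent' : Summable fun n => negMulLog (P n) := by
    simp only [hterm]
    exact hent.neg.mul_right _
  have hH : (-∑' n, P n * logb 2 (P n)) * log 2 = ∑' n, negMulLog (P n) := by
    simp only [hterm]
    rw [tsum_mul_right, tsum_neg]
  have hT := summable_mul_natLog hnonneg hanti hsum hP0' hent'
  rw [tsum_runLength_codeLength hsum hP0.le hP0' hT]
  refine mul_le_mul_of_nonneg_left (le_of_mul_le_mul_right ?_ h2) zero_le_two
  rw [hH]
  have hE := geometric_natLog_mul_log_two_le hP0.le hP0'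
  have hE' := geometric_natLog_le hP0.le hP0'
  rcases le_total (P 0) (4 / 11) with h | h
  · have hA := tail_mass_add_natLog_le_entropy hnonneg hanti hsum hP0 hent' hT
    have h1 : log 2 * (1 + (1 - P 0) * ∑' i : ℕ, P 0 ^ i * (Nat.log 2 (i + 1) : ℝ)) ≤ 1 :=
      le_trans (by gcongr) (geometric_codeLength_le_one hP0.le h)
    have h3 := mul_le_mul_of_nonneg_left h1 (sub_nonneg.2 hP0'.le)
    linarith
  · have hB := binEntropy_add_natLog_le_entropy hnonneg hanti hsum hP0' hent'
    have h3 := codeLength_le_binEntropy h hP0' hE hE'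
    linarith
end
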